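/- arXiv:2102.04730 — 3 statements merged into one kernel-verified Lean document; each statement's English description precedes it below -/
import Mathlib

section
/- Let B ≥ 2 be an integer, E > 0, σ² > 0 and μ > 0. Define the state evolution recursion by ψ⁰ = E and, for t ≥ 0, τᵗ = σ² + μψᵗ and ψᵗ⁺¹ = mmse(1/τᵗ). Then: (i) the set of fixed points {ψ ∈ [0, E] : ψ = mmse(1/(σ² + μψ))} is nonempty and has a maximum element ψ^FP; (ii) the sequences (ψᵗ)_{t≥0} and (τᵗ)_{t≥0} are non-increasing; and (iii) ψᵗ converges to ψ^FP and τᵗ converges to τ^FP := σ² + μψ^FP as t → ∞. -/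
open MeasureTheory ProbabilityTheory Real Filter

noncomputable section

/-- The standard Gaussian measure on `ℝ`. -/
def stdGaussian : Measure ℝ := gaussianReal 0 1

/-- The law of `B` i.i.d. standard Gaussians. -/
def gaussPi (B : ℕ) : Measure (Fin B → ℝ) := Measure.pi fun _ => gaussianReal 0 1

/-- `mmse(1/τ)` for the prior `p₁` (uniform over the `B` vectors with one nonzero
entry equal to `√E`), i.e. the MMSE of estimating `X ~ p₁` from `X + √τ Z`. -/
def mmseFn (B : ℕ) [NeZero B] (E τ : ℝ) : ℝ :=
  E * (1 - ∫ z, exp (sqrt (E / τ) * z 0) /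
      (exp (sqrt (E / τ) * z 0) +
        exp (-(E / τ)) * ∑ j ∈ Finset.univ.erase (0 : Fin B), exp (sqrt (E / τ) * z j))
    ∂ gaussPi B)

/-- State evolution sequence `ψᵗ`: `ψ⁰ = E` and `ψᵗ⁺¹ = mmse(1/(σ² + μψᵗ))`. -/
def seψ (B : ℕ) [NeZero B] (E σ2 μ : ℝ) : ℕ → ℝ
  | 0 => E
  | t + 1 => mmseFn B E (σ2 + μ * seψ B E σ2 μ t)

/-- State evolution sequence `τᵗ = σ² + μψᵗ`. -/
def seτ (B : ℕ) [NeZero B] (E σ2 μ : ℝ) (t : ℕ) : ℝ := σ2 + μ * seψ B E σ2 μ t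

/-- The set of fixed points `{ψ ∈ [0,E] : ψ = mmse(1/(σ² + μψ))}`. -/
def fpSet (B : ℕ) [NeZero B] (E σ2 μ : ℝ) : Set ℝ :=
  {ψ | ψ ∈ Set.Icc 0 E ∧ ψ = mmseFn B E (σ2 + μ * ψ)}

lemma aux_shift1 (a : ℝ) (h : ℝ → ℝ) :
    ∫ x, h (x + a) ∂(gaussianReal 0 1) =
      ∫ x, exp (a * x - a ^ 2 / 2) * h x ∂(gaussianReal 0 1) := by
  rw [integral_gaussianReal_eq_integral_smul one_ne_zero,
    integral_gaussianReal_eq_integral_smul one_ne_zero,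
    ← integral_add_right_eq_self (μ := volume)
      (fun x => gaussianPDFReal 0 1 x • (exp (a * x - a ^ 2 / 2) * h x)) a]
  congr 1
  ext x
  simp only [gaussianPDFReal, smul_eq_mul, NNReal.coe_one]
  rw [← mul_assoc, mul_assoc _ (exp _) (exp _), ← exp_add]
  congr 3
  ring_nf

/-- Change of measure in coordinate `0`. -/
lemma aux_shift (n : ℕ) (a : ℝ) (f : (Fin (n + 1) → ℝ) → ℝ) (hf : Measurable f)
    (hb : ∀ z, |f z| ≤ 1) :
    ∫ z, f (z + Pi.single 0 a) ∂(gaussPi (n + 1)) =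
      ∫ z, exp (a * z 0 - a ^ 2 / 2) * f z ∂(gaussPi (n + 1)) := by
  have hmp := (measurePreserving_piFinSuccAbove
    (fun _ : Fin (n + 1) => gaussianReal 0 1) 0).symm
  have e1 : ∀ g : (Fin (n + 1) → ℝ) → ℝ,
      ∫ z, g z ∂(gaussPi (n + 1)) = ∫ p, g (Fin.cons p.1 p.2)
        ∂((gaussianReal 0 1).prod (Measure.pi fun _ : Fin n => gaussianReal 0 1)) := by
    intro g
    have := hmp.integral_comp (MeasurableEquiv.measurableEmbedding _) g
    rw [gaussPi, ← this]
    congr 1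
    ext p
    simp [MeasurableEquiv.piFinSuccAbove, Fin.insertNthEquiv]
  have hcons : Measurable (fun p : ℝ × (Fin n → ℝ) => (Fin.cons p.1 p.2 : Fin (n + 1) → ℝ)) := by
    refine measurable_pi_lambda _ fun i => ?_
    refine Fin.cases ?_ (fun j => ?_) i
    · simpa using measurable_fst
    · simp only [Fin.cons_succ]
      fun_prop
  have hexp : Integrable (fun x : ℝ => exp (a * x - a ^ 2 / 2)) (gaussianReal 0 1) := by
    simp_rw [sub_eq_add_neg, exp_add]
    exact (integrable_exp_mul_gaussianReal a).mul_const _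
  rw [e1, e1, integral_prod_symm, integral_prod_symm]
  · congr 1
    ext y
    have := aux_shift1 a (fun x => f (Fin.cons x y))
    simp only [Fin.cons_zero]
    rw [← this]
    congr 1
    ext x
    congr 1
    ext i
    refine Fin.cases ?_ (fun j => ?_) i <;> simp
  · have h1 : Integrable (fun p : ℝ × (Fin n → ℝ) => exp (a * p.1 - a ^ 2 / 2))
        ((gaussianReal 0 1).prod (Measure.pi fun _ : Fin n => gaussianReal 0 1)) :=
      hexp.comp_fst _
    refine h1.mono' ?_ ?_
    · simp only [Fin.cons_zero]
      exact (Measurable.mul (by fun_prop) (hf.comp hcons)).aestronglyMeasurable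
    · refine Eventually.of_forall fun p => ?_
      simp only [Fin.cons_zero, norm_mul, Real.norm_eq_abs, abs_exp]
      exact mul_le_of_le_one_right (exp_pos _).le (hb _)
  · refine (integrable_const (1 : ℝ)).mono' ?_ (Eventually.of_forall fun p => hb _)
    exact (hf.comp (hcons.add_const _)).aestronglyMeasurable

/-- The law of i.i.d. Gaussians of variance `v`. -/
def gPi (B : ℕ) (v : NNReal) : Measure (Fin B → ℝ) := Measure.pi fun _ => gaussianReal 0 v

instance (B : ℕ) (v : NNReal) : IsProbabilityMeasure (gPi B v) := by
  unfold gPi; infer_instance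

instance (B : ℕ) : IsProbabilityMeasure (gaussPi B) := by
  unfold gaussPi; infer_instance

lemma aux_scale (B : ℕ) (v : NNReal) :
    MeasurePreserving (fun (z : Fin B → ℝ) i => sqrt v * z i) (gaussPi B) (gPi B v) := by
  refine measurePreserving_pi _ _ fun i => ⟨by fun_prop, ?_⟩
  rw [gaussianReal_map_const_mul]
  congr 1
  · simp
  · ext; simp

lemma aux_add (B : ℕ) (v u : NNReal) :
    MeasurePreserving (fun p : (Fin B → ℝ) × (Fin B → ℝ) => p.1 + p.2)
      ((gPi B v).prod (gPi B u)) (gPi B (v + u)) := by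
  have h1 := (measurePreserving_arrowProdEquivProdArrow ℝ ℝ (Fin B)
    (fun _ => gaussianReal 0 v) (fun _ => gaussianReal 0 u)).symm
  have h2 : MeasurePreserving (fun (a : Fin B → ℝ × ℝ) i => (a i).1 + (a i).2)
      (Measure.pi fun _ => (gaussianReal 0 v).prod (gaussianReal 0 u)) (gPi B (v + u)) := by
    refine measurePreserving_pi (f := fun _ (p : ℝ × ℝ) => p.1 + p.2) _ _ fun i => ⟨by fun_prop, ?_⟩
    have := gaussianReal_conv_gaussianReal (m₁ := 0) (m₂ := 0) (v₁ := v) (v₂ := u)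
    rw [add_zero] at this
    exact this
  exact h2.comp h1

/-- `exp(y₀)² / ∑ exp(y_j)`. -/
def aφ {B : ℕ} [NeZero B] (y : Fin B → ℝ) : ℝ := exp (y 0) ^ 2 / ∑ j, exp (y j)

lemma aux_S_pos {B : ℕ} [NeZero B] (y : Fin B → ℝ) : 0 < ∑ j, exp (y j) :=
  Finset.sum_pos (fun _ _ => exp_pos _) Finset.univ_nonempty

lemma aux_le_S {B : ℕ} [NeZero B] (y : Fin B → ℝ) : exp (y 0) ≤ ∑ j, exp (y j) :=
  Finset.single_le_sum (f := fun j => exp (y j)) (fun _ _ => (exp_pos _).le) (Finset.mem_univ 0)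

lemma aux_φ_nonneg {B : ℕ} [NeZero B] (y : Fin B → ℝ) : 0 ≤ aφ y :=
  div_nonneg (sq_nonneg _) (aux_S_pos y).le

lemma aux_φ_le {B : ℕ} [NeZero B] (y : Fin B → ℝ) : aφ y ≤ exp (y 0) := by
  rw [aφ, div_le_iff₀ (aux_S_pos y), sq]
  exact mul_le_mul_of_nonneg_left (aux_le_S y) (exp_pos _).le

lemma aux_φ_meas {B : ℕ} [NeZero B] : Measurable (aφ : (Fin B → ℝ) → ℝ) := by
  unfold aφ; fun_prop

lemma aux_exp_int (B : ℕ) (v : NNReal) (j : Fin B) :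
    Integrable (fun y : Fin B → ℝ => exp (y j)) (gPi B v) := by
  have := integrable_exp_mul_gaussianReal (μ := 0) (v := v) 1
  simp only [one_mul] at this
  exact integrable_comp_eval (μ := fun _ : Fin B => gaussianReal 0 v) (i := j) this

lemma aux_exp_integral (B : ℕ) (v : NNReal) (j : Fin B) :
    ∫ y, exp (y j) ∂(gPi B v) = exp (v / 2) := by
  have h := integral_comp_eval (μ := fun _ : Fin B => gaussianReal 0 v) (i := j) (f := exp)
    (by fun_prop)
  rw [gPi, h]
  have := congrFun (mgf_id_gaussianReal (μ := 0) (v := v)) 1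
  simpa [mgf] using this

lemma aux_φ_int (B : ℕ) [NeZero B] (v : NNReal) : Integrable aφ (gPi B v) := by
  refine (aux_exp_int B v 0).mono' aux_φ_meas.aestronglyMeasurable
    (Eventually.of_forall fun y => ?_)
  rw [Real.norm_eq_abs, abs_of_nonneg (aux_φ_nonneg y)]
  exact aux_φ_le y

lemma aux_tangent {B : ℕ} [NeZero B] (y w : Fin B → ℝ) :
    2 * (exp (y 0) / ∑ j, exp (y j)) * exp (y 0) * exp (w 0) -
      (exp (y 0) / ∑ j, exp (y j)) ^ 2 * ∑ j, exp (y j) * exp (w j) ≤ aφ (y + w) := by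
  have hS := aux_S_pos (y + w)
  simp only [aφ]
  rw [le_div_iff₀ hS]
  simp only [Pi.add_apply, exp_add] at hS ⊢
  set S := ∑ j, exp (y j) * exp (w j)
  set c := exp (y 0) / ∑ j, exp (y j)
  nlinarith [sq_nonneg (exp (y 0) * exp (w 0) - c * S)]

lemma aux_inner (B : ℕ) [NeZero B] (u : NNReal) (y : Fin B → ℝ)
    (hi : Integrable (fun w => aφ (y + w)) (gPi B u)) :
    exp (u / 2) * aφ y ≤ ∫ w, aφ (y + w) ∂(gPi B u) := by
  have hsumI : Integrable (fun w : Fin B → ℝ => ∑ j, exp (y j) * exp (w j)) (gPi B u) :=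
    integrable_finsetSum _ fun j _ => (aux_exp_int B u j).const_mul _
  have h0 := (aux_exp_int B u (0 : Fin B)).const_mul
    (2 * (exp (y 0) / ∑ j, exp (y j)) * exp (y 0))
  have hsumI2 := hsumI.const_mul ((exp (y 0) / ∑ j, exp (y j)) ^ 2)
  have := integral_mono (h0.sub hsumI2) hi (fun w => aux_tangent y w)
  refine le_trans (le_of_eq ?_) this
  simp only [Pi.sub_apply]
  rw [integral_sub h0 hsumI2, integral_const_mul, integral_const_mul,
    integral_finsetSum _ fun j _ => (aux_exp_int B u j).const_mul _]
  simp only [integral_const_mul, aux_exp_integral, ← Finset.sum_mul, aφ]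
  have hS := (aux_S_pos y).ne'
  field_simp
  ring

lemma aux_mono (B : ℕ) [NeZero B] (v u : NNReal) :
    exp (-(v : ℝ) / 2) * ∫ y, aφ y ∂(gPi B v) ≤
      exp (-((v + u : NNReal) : ℝ) / 2) * ∫ y, aφ y ∂(gPi B (v + u)) := by
  have hmp := aux_add B v u
  have hφ : AEStronglyMeasurable (aφ : (Fin B → ℝ) → ℝ) (gPi B (v + u)) :=
    aux_φ_meas.aestronglyMeasurable
  have h1 : ∫ y, aφ y ∂(gPi B (v + u)) =
      ∫ p, aφ (p.1 + p.2) ∂((gPi B v).prod (gPi B u)) := by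
    rw [← hmp.map_eq] at hφ ⊢
    exact integral_map hmp.measurable.aemeasurable hφ
  have hI : Integrable (fun p : (Fin B → ℝ) × (Fin B → ℝ) => aφ (p.1 + p.2))
      ((gPi B v).prod (gPi B u)) :=
    hmp.integrable_comp_of_integrable (aux_φ_int B (v + u))
  have h2 : exp (u / 2) * ∫ y, aφ y ∂(gPi B v) ≤ ∫ y, aφ y ∂(gPi B (v + u)) := by
    rw [h1, integral_prod _ hI, ← integral_const_mul]
    refine integral_mono_ae ((aux_φ_int B v).const_mul _) hI.integral_prod_left ?_
    filter_upwards [hI.prod_right_ae] with y hy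
    exact aux_inner B u y hy
  refine le_trans (le_of_eq ?_) (mul_le_mul_of_nonneg_left h2 (exp_pos _).le)
  rw [← mul_assoc, ← exp_add]
  congr 2
  push_cast
  ring

/-- The integrand in `mmseFn`. -/
def aK {B : ℕ} [NeZero B] (s : ℝ) (z : Fin B → ℝ) : ℝ :=
  exp (sqrt s * z 0) / (exp (sqrt s * z 0) +
    exp (-s) * ∑ j ∈ Finset.univ.erase (0 : Fin B), exp (sqrt s * z j))

lemma aux_den_pos {B : ℕ} [NeZero B] (s : ℝ) (z : Fin B → ℝ) :
    0 < exp (sqrt s * z 0) +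
    exp (-s) * ∑ j ∈ Finset.univ.erase (0 : Fin B), exp (sqrt s * z j) := by
  have : 0 ≤ ∑ j ∈ Finset.univ.erase (0 : Fin B), exp (sqrt s * z j) :=
    Finset.sum_nonneg fun _ _ => (exp_pos _).le
  positivity

lemma aux_K_nonneg {B : ℕ} [NeZero B] (s : ℝ) (z : Fin B → ℝ) : 0 ≤ aK s z :=
  div_nonneg (exp_pos _).le (aux_den_pos s z).le

lemma aux_K_le {B : ℕ} [NeZero B] (s : ℝ) (z : Fin B → ℝ) : aK s z ≤ 1 := by
  rw [aK, div_le_one (aux_den_pos s z)]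
  have : 0 ≤ ∑ j ∈ Finset.univ.erase (0 : Fin B), exp (sqrt s * z j) :=
    Finset.sum_nonneg fun _ _ => (exp_pos _).le
  have := mul_nonneg (exp_pos (-s)).le this
  linarith

lemma aux_K_meas {B : ℕ} [NeZero B] (s : ℝ) : Measurable (aK s : (Fin B → ℝ) → ℝ) := by
  unfold aK; fun_prop

lemma aux_K_int {B : ℕ} [NeZero B] (s : ℝ) : Integrable (aK s) (gaussPi B) := by
  refine (integrable_const (1 : ℝ)).mono' (aux_K_meas s).aestronglyMeasurable
    (Eventually.of_forall fun y => ?_)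
  rw [Real.norm_eq_abs, abs_of_nonneg (aux_K_nonneg s y)]
  exact aux_K_le s y

lemma aux_K_eq (B : ℕ) [inst : NeZero B] (v : NNReal) :
    ∫ z, aK (v : ℝ) z ∂(gaussPi B) = exp (-(v : ℝ) / 2) * ∫ y, aφ y ∂(gPi B v) := by
  have hmp := aux_scale B v
  have hφ : AEStronglyMeasurable (aφ : (Fin B → ℝ) → ℝ) (gPi B v) :=
    aux_φ_meas.aestronglyMeasurable
  have h1 : ∫ y, aφ y ∂(gPi B v) = ∫ z, aφ (fun i => sqrt v * z i) ∂(gaussPi B) := by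
    rw [← hmp.map_eq] at hφ ⊢
    exact integral_map hmp.measurable.aemeasurable hφ
  rw [h1, ← integral_const_mul]
  obtain ⟨n, rfl⟩ : ∃ n, B = n + 1 := ⟨B - 1, by have := inst.ne; omega⟩
  have hsq : sqrt (v : ℝ) ^ 2 = v := sq_sqrt v.2
  have h2 := aux_shift n (sqrt v)
    (fun z => exp (sqrt v * z 0) / ∑ j, exp (sqrt v * z j)) (by fun_prop) (by
      intro z
      have := aux_S_pos (fun j => sqrt v * z j)
      rw [abs_of_nonneg (div_nonneg (exp_pos _).le this.le), div_le_one this]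
      exact aux_le_S (fun j => sqrt v * z j))
  have h3 : ∀ z : Fin (n + 1) → ℝ, exp (-(v : ℝ) / 2) * aφ (fun i => sqrt v * z i) =
      exp (sqrt v * z 0 - sqrt v ^ 2 / 2) *
        (exp (sqrt v * z 0) / ∑ j, exp (sqrt v * z j)) := by
    intro z
    rw [hsq, sub_eq_add_neg, exp_add, aφ, neg_div]
    ring
  simp_rw [h3]
  rw [← h2]
  congr 1
  ext z
  have hpos := aux_den_pos (v : ℝ) z
  have hpos2 := aux_S_pos (fun j => sqrt v * (z + Pi.single 0 (sqrt (v : ℝ)) : Fin (n + 1) → ℝ) j)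
  have hev : exp (-(v : ℝ)) * exp v = 1 := by rw [← exp_add]; simp
  rw [aK, div_eq_div_iff hpos.ne' hpos2.ne']
  rw [← Finset.add_sum_erase _ _ (Finset.mem_univ (0 : Fin (n + 1)))]
  have h4 : ∑ j ∈ Finset.univ.erase (0 : Fin (n + 1)),
      exp (sqrt v * (z + Pi.single 0 (sqrt (v : ℝ)) : Fin (n + 1) → ℝ) j) =
      ∑ j ∈ Finset.univ.erase (0 : Fin (n + 1)), exp (sqrt v * z j) := by
    refine Finset.sum_congr rfl fun j hj => ?_
    have : j ≠ 0 := Finset.ne_of_mem_erase hj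
    simp [this]
  rw [h4]
  have h5 : exp (sqrt v * (z + Pi.single 0 (sqrt (v : ℝ)) : Fin (n + 1) → ℝ) 0) =
      exp (sqrt v * z 0) * exp v := by
    rw [← exp_add]
    congr 1
    have : sqrt (v : ℝ) * sqrt v = v := by rw [← sq, hsq]
    simp [mul_add, this]
  rw [h5]
  linear_combination (-(exp (sqrt v * z 0) *
    ∑ j ∈ Finset.univ.erase (0 : Fin (n + 1)), exp (sqrt v * z j))) * hev

lemma aux_K_mono (B : ℕ) [NeZero B] {s t : ℝ} (hs : 0 ≤ s) (hst : s ≤ t) :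
    ∫ z, aK s z ∂(gaussPi B) ≤ ∫ z, aK t z ∂(gaussPi B) := by
  lift s to NNReal using hs
  obtain ⟨u, hu⟩ : ∃ u : NNReal, (u : ℝ) = t - s := ⟨(t - s).toNNReal, by
    rw [Real.coe_toNNReal _ (sub_nonneg.2 hst)]⟩
  have h := aux_mono B s u
  rw [← aux_K_eq, ← aux_K_eq, NNReal.coe_add, hu, add_sub_cancel] at h
  exact h

lemma aux_K_cont (B : ℕ) [NeZero B] : Continuous fun s => ∫ z, aK s z ∂(gaussPi B) := by
  refine continuous_of_dominated (bound := fun _ => 1)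
    (fun s => (aux_K_meas s).aestronglyMeasurable) (fun s => Eventually.of_forall fun z => ?_)
    (integrable_const _) (Eventually.of_forall fun z => ?_)
  · rw [Real.norm_eq_abs, abs_of_nonneg (aux_K_nonneg s z)]
    exact aux_K_le s z
  · unfold aK
    exact Continuous.div (by fun_prop) (by fun_prop) fun s => (aux_den_pos s z).ne'

lemma aux_mmse_eq (B : ℕ) [NeZero B] (E τ : ℝ) :
    mmseFn B E τ = E * (1 - ∫ z, aK (E / τ) z ∂(gaussPi B)) := rfl

lemma aux_mmse_nonneg (B : ℕ) [NeZero B] {E : ℝ} (hE : 0 < E) (τ : ℝ) : 0 ≤ mmseFn B E τ := by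
  rw [aux_mmse_eq]
  have := integral_mono (aux_K_int (B := B) (E / τ)) (integrable_const 1) (aux_K_le (E / τ))
  simp at this
  exact mul_nonneg hE.le (by linarith)

lemma aux_mmse_le (B : ℕ) [NeZero B] {E : ℝ} (hE : 0 < E) (τ : ℝ) : mmseFn B E τ ≤ E := by
  rw [aux_mmse_eq]
  have : 0 ≤ ∫ z, aK (E / τ) z ∂(gaussPi B) := integral_nonneg (aux_K_nonneg (E / τ))
  nlinarith

lemma aux_mmse_mono (B : ℕ) [NeZero B] {E τ₁ τ₂ : ℝ} (hE : 0 < E) (h1 : 0 < τ₁) (h : τ₁ ≤ τ₂) :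
    mmseFn B E τ₁ ≤ mmseFn B E τ₂ := by
  rw [aux_mmse_eq, aux_mmse_eq]
  have := aux_K_mono B (s := E / τ₂) (t := E / τ₁) (div_nonneg hE.le (h1.le.trans h))
    (div_le_div_of_nonneg_left hE.le h1 h)
  exact mul_le_mul_of_nonneg_left (by linarith) hE.le

/-- the state evolution sequences are non-increasing, the fixed point set
has a greatest element `ψ^FP`, and `ψᵗ → ψ^FP`, `τᵗ → τ^FP = σ² + μ ψ^FP`. -/
theorem stmt0 (B : ℕ) [NeZero B] (hB : 2 ≤ B) (E σ2 μ : ℝ)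
    (hE : 0 < E) (hσ : 0 < σ2) (hμ : 0 < μ) :
    ∃ ψFP : ℝ, IsGreatest (fpSet B E σ2 μ) ψFP ∧
      (∀ t, seψ B E σ2 μ (t + 1) ≤ seψ B E σ2 μ t) ∧
      (∀ t, seτ B E σ2 μ (t + 1) ≤ seτ B E σ2 μ t) ∧
      Tendsto (seψ B E σ2 μ) atTop (nhds ψFP) ∧
      Tendsto (seτ B E σ2 μ) atTop (nhds (σ2 + μ * ψFP)) := by
  have hnn : ∀ t, 0 ≤ seψ B E σ2 μ t := by
    intro t
    cases t with
    | zero => exact hE.le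
    | succ t => exact aux_mmse_nonneg B hE _
  have hT : ∀ x y, 0 ≤ x → x ≤ y →
      mmseFn B E (σ2 + μ * x) ≤ mmseFn B E (σ2 + μ * y) := fun x y hx hxy =>
    aux_mmse_mono B hE (by positivity) (by
      have := mul_le_mul_of_nonneg_left hxy hμ.le
      linarith)
  have hdec : ∀ t, seψ B E σ2 μ (t + 1) ≤ seψ B E σ2 μ t := by
    intro t
    induction t with
    | zero => exact aux_mmse_le B hE _
    | succ t ih => exact hT _ _ (hnn _) ih
  have hanti : Antitone (seψ B E σ2 μ) := antitone_nat_of_succ_le hdec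
  have hlim := tendsto_atTop_ciInf hanti ⟨0, by rintro _ ⟨t, rfl⟩; exact hnn t⟩
  set L := ⨅ t, seψ B E σ2 μ t
  have hL0 : 0 ≤ L := ge_of_tendsto' hlim hnn
  have hLE : L ≤ E := le_of_tendsto' hlim fun t => hanti (Nat.zero_le t)
  have hτ : Tendsto (seτ B E σ2 μ) atTop (nhds (σ2 + μ * L)) :=
    (hlim.const_mul μ).const_add σ2
  have hfix : L = mmseFn B E (σ2 + μ * L) := by
    have hpos : σ2 + μ * L ≠ 0 := by positivity
    have h1 : Tendsto (fun t => E / seτ B E σ2 μ t) atTop (nhds (E / (σ2 + μ * L))) :=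
      tendsto_const_nhds.div hτ hpos
    have h2 := (((aux_K_cont B).tendsto _).comp h1).const_sub 1 |>.const_mul E
    have h3 : Tendsto (fun t => seψ B E σ2 μ (t + 1)) atTop
        (nhds (mmseFn B E (σ2 + μ * L))) := h2
    exact tendsto_nhds_unique ((tendsto_add_atTop_iff_nat 1).2 hlim) h3
  refine ⟨L, ⟨⟨⟨hL0, hLE⟩, hfix⟩, ?_⟩, hdec, ?_, hlim, hτ⟩
  · rintro x ⟨⟨hx0, hxE⟩, hx⟩
    refine ge_of_tendsto' hlim fun t => ?_
    induction t with
    | zero => exact hxE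
    | succ t ih => rw [hx]; exact hT _ _ hx0 ih
  · intro t
    have := mul_le_mul_of_nonneg_left (hdec t) hμ.le
    simp only [seτ]
    linarith

end
end

section
/- Let B ≥ 2 be an integer, E > 0, σ² > 0 and μ > 0. The potential function ψ ↦ F(μ, σ², ψ) is differentiable on (0, E), with derivative ∂F(μ, σ², ψ)/∂ψ = [μ / (2(σ² + μψ)²)] · (ψ − mmse(1/(σ² + μψ))). Consequently, a point ψ ∈ (0, E) satisfies ∂F(μ, σ², ψ)/∂ψ = 0 if and only if ψ = mmse(1/(σ² + μψ)), i.e., the stationary points of the potential function coincide with the fixed points of the state evolution map ψ ↦ mmse(1/(σ² + μψ)). -/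
open MeasureTheory ProbabilityTheory Real Filter

noncomputable section

/-- The mutual information `I(X; X + √τ Z)` for `X ~ p₁`:
`I(τ) = E/τ + ln B − 𝔼 ln[exp(E/τ + √(E/τ)Z₁) + Σ_{j≥2} exp(√(E/τ)Z_j)]`. -/
def miFn (B : ℕ) [NeZero B] (E τ : ℝ) : ℝ :=
  E / τ + Real.log B - ∫ z, Real.log (exp (E / τ + sqrt (E / τ) * z 0) +
      ∑ j ∈ Finset.univ.erase (0 : Fin B), exp (sqrt (E / τ) * z j)) ∂ gaussPi B

/-- The potential function `F(μ, σ², ψ) = I(τ) + (1/(2μ))[ln(τ/σ²) − μψ/τ]`, `τ = σ² + μψ`. -/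
def potF (B : ℕ) [NeZero B] (E μ σ2 ψ : ℝ) : ℝ :=
  miFn B E (σ2 + μ * ψ) +
    1 / (2 * μ) * (Real.log ((σ2 + μ * ψ) / σ2) - μ * ψ / (σ2 + μ * ψ))

instance gaussPi_prob (B : ℕ) : IsProbabilityMeasure (gaussPi B) := by
  unfold gaussPi; infer_instance

lemma gaussPi_lift {B : ℕ} (i : Fin B) (F G : (Fin B → ℝ) → ℝ)
    (hF : Integrable F (gaussPi B)) (hG : Integrable G (gaussPi B))
    (h : ∀ z, ∫ x, F (Function.update z i x) ∂(gaussianReal 0 1)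
      = ∫ x, G (Function.update z i x) ∂(gaussianReal 0 1)) :
    ∫ z, F z ∂(gaussPi B) = ∫ z, G z ∂(gaussPi B) := by
  cases B with
  | zero => exact i.elim0
  | succ n =>
    have mp := (measurePreserving_piFinSuccAbove
      (fun _ : Fin (n+1) => gaussianReal 0 1) i).symm
    have key : ∀ F : (Fin (n+1) → ℝ) → ℝ, Integrable F (gaussPi (n+1)) →
        ∫ z, F z ∂(gaussPi (n+1)) = ∫ z, ∫ x, F (i.insertNth x z) ∂(gaussianReal 0 1)
          ∂(Measure.pi fun _ : Fin n => gaussianReal 0 1) := by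
      intro F hF
      unfold gaussPi at hF ⊢
      rw [← mp.integral_comp']
      have h2 := (mp.integrable_comp_emb (MeasurableEquiv.measurableEmbedding _)).2 hF
      exact integral_prod_symm _ h2
    rw [key F hF, key G hG]
    congr 1
    ext z
    have := h (i.insertNth 0 z)
    simpa using this

lemma gauss_shift (f : ℝ → ℝ) (g : ℝ) :
    ∫ x, f (x + g) ∂(gaussianReal 0 1)
      = ∫ x, f x * exp (g * x - g ^ 2 / 2) ∂(gaussianReal 0 1) := by
  rw [integral_gaussianReal_eq_integral_smul one_ne_zero,
    integral_gaussianReal_eq_integral_smul one_ne_zero]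
  rw [← integral_add_right_eq_self (fun x => gaussianPDFReal 0 1 x • (f x * exp (g * x - g ^ 2 / 2))) g]
  congr 1
  ext x
  simp only [gaussianPDFReal, smul_eq_mul]
  have : rexp (-(x + g - 0) ^ 2 / (2 * ((1 : NNReal) : ℝ))) * rexp (g * (x + g) - g ^ 2 / 2)
      = rexp (-(x - 0) ^ 2 / (2 * ((1 : NNReal) : ℝ))) := by
    rw [← Real.exp_add]; congr 1; push_cast; ring
  rw [← this]; ring

lemma gauss_integrable_iff (f : ℝ → ℝ) :
    Integrable f (gaussianReal 0 1) ↔ Integrable (fun x => f x * gaussianPDFReal 0 1 x) := by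
  rw [gaussianReal_of_var_ne_zero _ one_ne_zero,
    integrable_withDensity_iff (measurable_gaussianPDF _ _) (ae_of_all _ fun _ ↦ gaussianPDF_lt_top)]
  simp [toReal_gaussianPDF]

lemma gauss_stein (f f' : ℝ → ℝ) (hf : ∀ x, HasDerivAt f (f' x) x)
    (h1 : Integrable f (gaussianReal 0 1))
    (h2 : Integrable (fun x => x * f x) (gaussianReal 0 1))
    (h3 : Integrable f' (gaussianReal 0 1)) :
    ∫ x, x * f x ∂(gaussianReal 0 1) = ∫ x, f' x ∂(gaussianReal 0 1) := by
  rw [integral_gaussianReal_eq_integral_smul one_ne_zero,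
    integral_gaussianReal_eq_integral_smul one_ne_zero]
  rw [gauss_integrable_iff] at h1 h2 h3
  have hd : ∀ x, HasDerivAt (gaussianPDFReal 0 1) (-(x * gaussianPDFReal 0 1 x)) x := by
    intro x
    unfold gaussianPDFReal
    have h : HasDerivAt (fun x : ℝ => -(x - 0) ^ 2 / (2 * ((1 : NNReal) : ℝ))) (-x) x := by
      have := ((((hasDerivAt_id x).sub_const 0).pow 2).neg).div_const (2 * ((1 : NNReal) : ℝ))
      refine this.congr_deriv ?_
      simp
      ring
    have := (h.exp).const_mul (√(2 * π * ((1 : NNReal) : ℝ)))⁻¹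
    refine this.congr_deriv ?_
    ring
  have := integral_mul_deriv_eq_deriv_mul_of_integrable (u := f) (u' := f')
    (v := gaussianPDFReal 0 1) (v' := fun x => -(x * gaussianPDFReal 0 1 x))
    (fun x _ => hf x) (fun x _ => hd x)
    (by
      refine h2.neg.congr (ae_of_all _ fun x => ?_)
      simp; ring)
    h3 h1
  rw [show (fun x => gaussianPDFReal 0 1 x • (x * f x))
      = fun x => -(f x * -(x * gaussianPDFReal 0 1 x)) by ext x; simp; ring, integral_neg, this,
      neg_neg]
  congr 1; ext x; simp; ring

lemma gaussPi_int_eval {B : ℕ} (i : Fin B) : Integrable (fun z => z i) (gaussPi B) := by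
  have h : Integrable (fun x : ℝ => x) (gaussianReal 0 1) :=
    (memLp_id_gaussianReal (μ := 0) (v := 1) 1).integrable (by simp)
  exact integrable_comp_eval (μ := fun _ : Fin B => gaussianReal 0 1) (i := i) (f := fun x => x) h

lemma gaussPi_int_exp {B : ℕ} (i : Fin B) (g : ℝ) :
    Integrable (fun z => exp (g * z i)) (gaussPi B) :=
  integrable_comp_eval (μ := fun _ : Fin B => gaussianReal 0 1) (i := i)
    (f := fun x => exp (g * x)) (integrable_exp_mul_gaussianReal g)

lemma gaussPi_int_bdd {B : ℕ} {Φ : (Fin B → ℝ) → ℝ} (hm : Measurable Φ) {C : ℝ}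
    (hb : ∀ z, |Φ z| ≤ C) : Integrable Φ (gaussPi B) :=
  Integrable.of_bound hm.aestronglyMeasurable C (ae_of_all _ hb)

lemma gaussPi_stein {B : ℕ} (i : Fin B) (Φ Φ' : (Fin B → ℝ) → ℝ) (hm : Measurable Φ)
    (hm' : Measurable Φ') (C C' : ℝ) (hb : ∀ z, |Φ z| ≤ C) (hb' : ∀ z, |Φ' z| ≤ C')
    (hd : ∀ z x, HasDerivAt (fun x => Φ (Function.update z i x)) (Φ' (Function.update z i x)) x) :
    ∫ z, z i * Φ z ∂(gaussPi B) = ∫ z, Φ' z ∂(gaussPi B) := by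
  refine gaussPi_lift i _ _ ?_ (gaussPi_int_bdd hm' hb') ?_
  · exact (gaussPi_int_eval i).mul_bdd hm.aestronglyMeasurable (ae_of_all _ hb)
  · intro z
    simp only [Function.update_self]
    have hu : Measurable (fun x : ℝ => Function.update z i x) := measurable_update z
    have h : Integrable (fun x : ℝ => x) (gaussianReal 0 1) :=
      (memLp_id_gaussianReal (μ := 0) (v := 1) 1).integrable (by simp)
    refine gauss_stein _ _ (hd z) ?_ ?_ ?_
    · exact Integrable.of_bound (hm.comp hu).aestronglyMeasurable C (ae_of_all _ fun x => hb _)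
    · exact h.mul_bdd (hm.comp hu).aestronglyMeasurable (ae_of_all _ fun x => hb _)
    · exact Integrable.of_bound (hm'.comp hu).aestronglyMeasurable C' (ae_of_all _ fun x => hb' _)

lemma gaussPi_shift {B : ℕ} (i : Fin B) (Φ : (Fin B → ℝ) → ℝ) (hm : Measurable Φ)
    (C : ℝ) (hb : ∀ z, |Φ z| ≤ C) (g : ℝ) :
    ∫ z, Φ (Function.update z i (z i + g)) ∂(gaussPi B)
      = ∫ z, Φ z * exp (g * z i - g ^ 2 / 2) ∂(gaussPi B) := by
  refine gaussPi_lift i _ _ ?_ ?_ ?_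
  · refine gaussPi_int_bdd (Φ := fun z => Φ (Function.update z i (z i + g))) (hm.comp ?_)
      (fun z => hb _)
    rw [measurable_pi_iff]
    intro k
    by_cases hk : k = i
    · subst hk; simp; fun_prop
    · simp [hk]; fun_prop
  · have : Integrable (fun z : Fin B → ℝ => exp (g * z i - g ^ 2 / 2)) (gaussPi B) := by
      simp_rw [Real.exp_sub]
      exact (gaussPi_int_exp i g).div_const _
    exact this.bdd_mul hm.aestronglyMeasurable (ae_of_all _ hb)
  · intro z
    simp only [Function.update_self, Function.update_idem]
    exact gauss_shift (fun x => Φ (Function.update z i x)) g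

lemma gaussPi_perm {B : ℕ} (σ : Equiv.Perm (Fin B)) (Φ : (Fin B → ℝ) → ℝ) :
    ∫ z, Φ (fun k => z (σ k)) ∂(gaussPi B) = ∫ z, Φ z ∂(gaussPi B) := by
  have mp := measurePreserving_piCongrLeft (fun _ : Fin B => gaussianReal 0 1) σ.symm
  have := mp.integral_comp' Φ
  unfold gaussPi
  rw [← this]
  congr 1
  ext z
  congr 1
  ext k
  have := Equiv.piCongrLeft_apply_apply (fun _ : Fin B => ℝ) σ.symm z (σ k)
  simp at this
  simp [MeasurableEquiv.coe_piCongrLeft, this]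

section main
variable {B : ℕ} [NeZero B]

/-- exponents -/
def ax (g : ℝ) (k : Fin B) (z : Fin B → ℝ) : ℝ := g * z k + if k = 0 then g ^ 2 else 0

/-- partition function -/
def Wf (g : ℝ) (z : Fin B → ℝ) : ℝ := ∑ k : Fin B, exp (ax g k z)

/-- weights -/
def wf (g : ℝ) (j : Fin B) (z : Fin B → ℝ) : ℝ := exp (ax g j z) / Wf g z

/-- unshifted weights -/
def qf (g : ℝ) (j : Fin B) (y : Fin B → ℝ) : ℝ := exp (g * y j) / ∑ k : Fin B, exp (g * y k)

lemma sum_exp_pos' (i : Fin B) (f : Fin B → ℝ) : 0 < ∑ k : Fin B, exp (f k) :=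
  Finset.sum_pos (fun _ _ => exp_pos _) ⟨i, Finset.mem_univ _⟩

lemma Wf_pos (g : ℝ) (z : Fin B → ℝ) : 0 < Wf g z := sum_exp_pos' 0 _

lemma wf_nonneg (g : ℝ) (j : Fin B) (z) : 0 ≤ wf g j z :=
  div_nonneg (exp_pos _).le (Wf_pos _ _).le

lemma wf_le_one (g : ℝ) (j : Fin B) (z) : wf g j z ≤ 1 := by
  unfold wf
  rw [div_le_one (Wf_pos _ _)]
  exact Finset.single_le_sum (f := fun k => exp (ax g k z)) (fun _ _ => (exp_pos _).le)
    (Finset.mem_univ j)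

lemma wf_sum (g : ℝ) (z : Fin B → ℝ) : ∑ j, wf g j z = 1 := by
  unfold wf
  rw [← Finset.sum_div]
  exact div_self (Wf_pos g z).ne'

lemma qf_nonneg (g : ℝ) (j : Fin B) (z) : 0 ≤ qf g j z :=
  div_nonneg (exp_pos _).le (sum_exp_pos' 0 _).le

lemma qf_le_one (g : ℝ) (j : Fin B) (z) : qf g j z ≤ 1 := by
  unfold qf
  rw [div_le_one (sum_exp_pos' 0 _)]
  exact Finset.single_le_sum (f := fun k => exp (g * z k)) (fun _ _ => (exp_pos _).le)
    (Finset.mem_univ j)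

lemma ax_meas (g : ℝ) (j : Fin B) : Measurable (ax g j) := by
  unfold ax; fun_prop

lemma Wf_meas (g : ℝ) : Measurable (Wf (B := B) g) := by
  unfold Wf
  exact Finset.measurable_fun_sum _ fun k _ => (ax_meas g k).exp

lemma wf_meas (g : ℝ) (j : Fin B) : Measurable (wf g j) :=
  (ax_meas g j).exp.div (Wf_meas g)

lemma qf_meas (g : ℝ) (j : Fin B) : Measurable (qf g j) := by
  unfold qf; fun_prop

lemma ax_shift (g : ℝ) (k : Fin B) (z : Fin B → ℝ) :
    g * (Function.update z 0 (z 0 + g)) k = ax g k z := by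
  unfold ax
  by_cases h : k = 0
  · subst h; simp; ring
  · simp [h]

lemma wf_eq_qf (g : ℝ) (j : Fin B) (z : Fin B → ℝ) :
    wf g j z = qf g j (Function.update z 0 (z 0 + g)) := by
  unfold wf qf Wf
  simp_rw [ax_shift]

lemma wf_stein (g : ℝ) (j : Fin B) :
    ∫ z, z j * wf g j z ∂(gaussPi B) = ∫ z, g * (wf g j z * (1 - wf g j z)) ∂(gaussPi B) := by
  have hm := wf_meas g j
  refine gaussPi_stein j _ _ hm (by fun_prop) 1 |g| ?_ ?_ ?_
  · intro z
    rw [abs_of_nonneg (wf_nonneg _ _ _)]; exact wf_le_one _ _ _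
  · intro z
    have h0 := wf_nonneg g j z
    have h1 := wf_le_one g j z
    rw [abs_mul, abs_of_nonneg (mul_nonneg h0 (by linarith))]
    exact mul_le_of_le_one_right (abs_nonneg _) (by nlinarith)
  · intro z x
    have hW : ∀ x, HasDerivAt (fun x => Wf g (Function.update z j x))
        (exp (ax g j (Function.update z j x)) * g) x := by
      intro x
      have h1 : ∀ k ∈ Finset.univ, HasDerivAt (fun x => exp (ax g k (Function.update z j x)))
          (if k = j then exp (ax g j (Function.update z j x)) * g else 0) x := by
        intro k _
        by_cases hk : k = j
        · subst hk
          simp only [if_true]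
          refine HasDerivAt.exp ?_
          simp only [ax, Function.update_self]
          simpa using ((hasDerivAt_id x).const_mul g).add_const (if k = 0 then g ^ 2 else 0)
        · simp only [ax, hk, ne_eq, not_false_eq_true, Function.update_of_ne, if_false]
          exact hasDerivAt_const _ _
      have := HasDerivAt.fun_sum h1
      simpa [Wf] using this
    have hN : HasDerivAt (fun x => exp (ax g j (Function.update z j x)))
        (exp (ax g j (Function.update z j x)) * g) x := by
      refine HasDerivAt.exp ?_
      simp only [ax, Function.update_self]
      simpa using ((hasDerivAt_id x).const_mul g).add_const (if j = 0 then g ^ 2 else 0)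
    have := hN.div (hW x) (Wf_pos _ _).ne'
    refine this.congr_deriv ?_
    have hp := (Wf_pos g (Function.update z j x)).ne'
    unfold wf
    field_simp

lemma qf_bd (g : ℝ) (j : Fin B) (z) : |qf g j z| ≤ 1 := by
  rw [abs_of_nonneg (qf_nonneg _ _ _)]; exact qf_le_one _ _ _

lemma qf_perm (g : ℝ) (j : Fin B) (σ : Equiv.Perm (Fin B)) (y : Fin B → ℝ) :
    qf g j (fun k => y (σ k)) = qf g (σ j) y := by
  unfold qf
  rw [Equiv.sum_comp σ (fun k => exp (g * y k))]

lemma qfsq_bd (g : ℝ) (y : Fin B → ℝ) : |∑ j, qf g j y ^ 2| ≤ B := by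
  rw [abs_of_nonneg (Finset.sum_nonneg fun _ _ => sq_nonneg _)]
  calc ∑ j, qf g j y ^ 2 ≤ ∑ j : Fin B, (1 : ℝ) := Finset.sum_le_sum fun j _ => by
        have := qf_nonneg g j y
        have := qf_le_one g j y
        nlinarith
    _ = B := by simp

lemma nishimori_q (g : ℝ) :
    ∫ y, (∑ j, qf g j y ^ 2) * exp (g * y 0) ∂(gaussPi B)
      = ∫ y, qf g 0 y * exp (g * y 0) ∂(gaussPi B) := by
  have hsm : Measurable (fun y : Fin B → ℝ => ∑ j, qf g j y ^ 2) :=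
    Finset.measurable_fun_sum _ fun k _ => (qf_meas g k).pow_const 2
  have i1 : ∀ k : Fin B, Integrable (fun y => (∑ j, qf g j y ^ 2) * exp (g * y k)) (gaussPi B) :=
    fun k => (gaussPi_int_exp k g).bdd_mul hsm.aestronglyMeasurable (ae_of_all _ (qfsq_bd g))
  have i2 : ∀ k : Fin B, Integrable (fun y => qf g k y * exp (g * y k)) (gaussPi B) :=
    fun k => (gaussPi_int_exp k g).bdd_mul (qf_meas g k).aestronglyMeasurable
      (ae_of_all _ (qf_bd g k))
  have e1 : ∀ k : Fin B, ∫ y, (∑ j, qf g j y ^ 2) * exp (g * y k) ∂(gaussPi B)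
      = ∫ y, (∑ j, qf g j y ^ 2) * exp (g * y 0) ∂(gaussPi B) := by
    intro k
    rw [← gaussPi_perm (Equiv.swap 0 k) (fun y => (∑ j, qf g j y ^ 2) * exp (g * y 0))]
    simp only [qf_perm, Equiv.swap_apply_left]
    congr 1; ext y
    rw [Equiv.sum_comp (Equiv.swap 0 k) (fun j => qf g j y ^ 2)]
  have e2 : ∀ k : Fin B, ∫ y, qf g k y * exp (g * y k) ∂(gaussPi B)
      = ∫ y, qf g 0 y * exp (g * y 0) ∂(gaussPi B) := by
    intro k
    rw [← gaussPi_perm (Equiv.swap 0 k) (fun y => qf g 0 y * exp (g * y 0))]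
    simp only [qf_perm, Equiv.swap_apply_left]
  have s1 := integral_finsetSum (Finset.univ : Finset (Fin B)) (fun k _ => i1 k)
  have s2 := integral_finsetSum (Finset.univ : Finset (Fin B)) (fun k _ => i2 k)
  have pt : ∀ y : Fin B → ℝ, ∑ k, (∑ j, qf g j y ^ 2) * exp (g * y k)
      = ∑ k, qf g k y * exp (g * y k) := by
    intro y
    have hp := (sum_exp_pos' (0 : Fin B) (fun k => g * y k)).ne'
    rw [← Finset.mul_sum, Finset.sum_mul]
    refine Finset.sum_congr rfl fun k _ => ?_
    unfold qf
    field_simp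
  simp only [pt] at s1
  rw [s1] at s2
  simp only [e1, e2, Finset.sum_const, Finset.card_univ, Fintype.card_fin, nsmul_eq_mul] at s2
  exact mul_left_cancel₀ (Nat.cast_ne_zero.2 (NeZero.ne B)) s2

lemma nishimori (g : ℝ) :
    ∫ z, (∑ j, wf g j z ^ 2) ∂(gaussPi B) = ∫ z, wf g 0 z ∂(gaussPi B) := by
  have hsm : Measurable (fun y : Fin B → ℝ => ∑ j, qf g j y ^ 2) :=
    Finset.measurable_fun_sum _ fun k _ => (qf_meas g k).pow_const 2
  simp only [wf_eq_qf]
  rw [gaussPi_shift 0 (fun y => ∑ j, qf g j y ^ 2) hsm B (qfsq_bd g) g,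
    gaussPi_shift 0 (qf g 0) (qf_meas g 0) 1 (qf_bd g 0) g]
  simp only [Real.exp_sub, ← mul_div_assoc, integral_div]
  rw [nishimori_q]

lemma log_Wf_bd (g : ℝ) (z : Fin B → ℝ) :
    |log (Wf g z)| ≤ log B + ∑ k, (|g| * |z k| + g ^ 2) := by
  have hB : (1 : ℝ) ≤ B := by exact_mod_cast NeZero.one_le
  have hlB := Real.log_nonneg hB
  have ha : ∀ k : Fin B, |ax g k z| ≤ ∑ k, (|g| * |z k| + g ^ 2) := by
    intro k
    refine le_trans ?_ (Finset.single_le_sum (f := fun k => |g| * |z k| + g ^ 2)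
      (fun _ _ => by positivity) (Finset.mem_univ k))
    unfold ax
    refine (abs_add_le _ _).trans ?_
    rw [abs_mul]
    gcongr
    split_ifs
    · simp
    · simp; positivity
  set M := ∑ k, (|g| * |z k| + g ^ 2)
  rw [abs_le]
  constructor
  · have : exp (ax g 0 z) ≤ Wf g z := Finset.single_le_sum (f := fun k => exp (ax g k z))
      (fun _ _ => (exp_pos _).le) (Finset.mem_univ 0)
    have := Real.log_le_log (exp_pos _) this
    rw [Real.log_exp] at this
    have := (abs_le.1 (ha 0)).1
    linarith
  · have : Wf g z ≤ B * exp M := by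
      calc Wf g z ≤ ∑ k : Fin B, exp M := Finset.sum_le_sum fun k _ =>
            exp_le_exp.2 ((le_abs_self _).trans (ha k))
        _ = B * exp M := by simp
    have := Real.log_le_log (Wf_pos _ _) this
    rwa [Real.log_mul (by positivity) (by positivity), Real.log_exp] at this

lemma lam_deriv (g : ℝ) :
    HasDerivAt (fun g => ∫ z, log (Wf g z) ∂(gaussPi B))
      (g * (1 + ∫ z, wf g 0 z ∂(gaussPi B))) g := by
  have hax : ∀ (z : Fin B → ℝ) (k : Fin B) (x : ℝ), HasDerivAt (fun x => ax x k z)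
      (z k + if k = 0 then 2 * x else 0) x := by
    intro z k x
    unfold ax
    have h1 : HasDerivAt (fun x : ℝ => x * z k) (z k) x := by
      simpa using (hasDerivAt_id x).mul_const (z k)
    refine h1.add ?_
    split_ifs
    · simpa using hasDerivAt_pow 2 x
    · exact hasDerivAt_const _ _
  have hint : Integrable (fun z : Fin B → ℝ => log (Wf g z)) (gaussPi B) := by
    refine Integrable.mono' (g := fun z => log B + ∑ k, (|g| * |z k| + g ^ 2)) ?_
      (Wf_meas g).log.aestronglyMeasurable (ae_of_all _ (log_Wf_bd g))
    refine (integrable_const _).add (integrable_finsetSum _ fun k _ => ?_)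
    exact ((gaussPi_int_eval k).abs.const_mul _).add (integrable_const _)
  have main := (hasDerivAt_integral_of_dominated_loc_of_deriv_le (μ := gaussPi B)
    (F := fun g z => log (Wf g z)) (x₀ := g) (s := Metric.ball g 1)
    (F' := fun x z => ∑ k, wf x k z * (z k + if k = 0 then 2 * x else 0))
    (bound := fun z => ∑ k, (|z k| + 2 * (|g| + 1)))
    (Metric.ball_mem_nhds g one_pos)
    (Eventually.of_forall fun x => (Wf_meas x).log.aestronglyMeasurable)
    hint
    (by
      refine (Finset.measurable_fun_sum _ fun k _ => (wf_meas g k).mul ?_).aestronglyMeasurable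
      fun_prop)
    (by
      refine ae_of_all _ fun z x hx => ?_
      rw [Metric.mem_ball, Real.dist_eq] at hx
      have hx' : |x| ≤ |g| + 1 := by
        have := abs_sub_abs_le_abs_sub x g
        linarith
      refine (norm_sum_le _ _).trans (Finset.sum_le_sum fun k _ => ?_)
      rw [Real.norm_eq_abs, abs_mul, abs_of_nonneg (wf_nonneg _ _ _)]
      refine (mul_le_of_le_one_left (abs_nonneg _) (wf_le_one _ _ _)).trans ?_
      refine (abs_add_le _ _).trans ?_
      gcongr
      split_ifs
      · rw [abs_mul, abs_two]; gcongr
      · rw [abs_zero]; positivity)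
    (integrable_finsetSum _ fun k _ => (gaussPi_int_eval k).abs.add (integrable_const _))
    (by
      refine ae_of_all _ fun z x _ => ?_
      have h1 : HasDerivAt (fun x => Wf x z)
          (∑ k, exp (ax x k z) * (z k + if k = 0 then 2 * x else 0)) x :=
        HasDerivAt.fun_sum fun k _ => (hax z k x).exp
      refine (h1.log (Wf_pos _ _).ne').congr_deriv ?_
      rw [Finset.sum_div]
      refine Finset.sum_congr rfl fun k _ => ?_
      unfold wf; ring)).2
  refine main.congr_deriv ?_
  have iw : ∀ k : Fin B, Integrable (wf g k) (gaussPi B) := fun k =>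
    gaussPi_int_bdd (wf_meas g k) (C := 1) fun z => by
      rw [abs_of_nonneg (wf_nonneg _ _ _)]; exact wf_le_one _ _ _
  have iw2 : ∀ k : Fin B, Integrable (fun z => wf g k z ^ 2) (gaussPi B) := fun k =>
    gaussPi_int_bdd ((wf_meas g k).pow_const 2) (C := 1) fun z => by
      rw [abs_of_nonneg (sq_nonneg _)]
      exact pow_le_one₀ (wf_nonneg _ _ _) (wf_le_one _ _ _)
  have izw : ∀ k : Fin B, Integrable (fun z => z k * wf g k z) (gaussPi B) := fun k =>
    (gaussPi_int_eval k).mul_bdd (c := 1) (wf_meas g k).aestronglyMeasurable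
      (ae_of_all _ fun z => by
        rw [Real.norm_eq_abs, abs_of_nonneg (wf_nonneg _ _ _)]; exact wf_le_one _ _ _)
  have split : ∀ z : Fin B → ℝ, ∑ k, wf g k z * (z k + if k = 0 then 2 * g else 0)
      = ∑ k, z k * wf g k z + 2 * g * wf g 0 z := by
    intro z
    simp only [mul_add, Finset.sum_add_distrib, mul_ite, mul_zero, Finset.sum_ite_eq',
      Finset.mem_univ, if_true]
    congr 1
    · exact Finset.sum_congr rfl fun k _ => mul_comm _ _
    · ring
  simp only [split]
  rw [integral_add (integrable_finsetSum _ fun k _ => izw k) ((iw 0).const_mul _),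
    integral_finsetSum _ (fun k _ => izw k), integral_const_mul]
  simp only [wf_stein]
  rw [← integral_finsetSum]
  · have : ∀ z : Fin B → ℝ, ∑ k, g * (wf g k z * (1 - wf g k z))
        = g * (1 - ∑ k, wf g k z ^ 2) := by
      intro z
      have h1 := wf_sum g z
      rw [← Finset.mul_sum]
      congr 1
      refine Eq.trans ?_ (congrArg (fun t => t - ∑ k, wf g k z ^ 2) h1)
      rw [← Finset.sum_sub_distrib]
      refine Finset.sum_congr rfl fun k _ => ?_
      ring
    simp only [this]
    rw [integral_const_mul, integral_sub (integrable_const _)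
      (integrable_finsetSum _ fun k _ => iw2 k), nishimori]
    simp
    ring
  · intro k _
    have := ((iw k).sub (iw2 k)).const_mul g
    refine this.congr (ae_of_all _ fun z => ?_)
    simp; left; ring

lemma miFn_eq (E τ : ℝ) (h : 0 ≤ E / τ) :
    miFn B E τ = E / τ + Real.log B - ∫ z, log (Wf (sqrt (E / τ)) z) ∂(gaussPi B) := by
  unfold miFn
  congr 2
  ext z
  congr 1
  unfold Wf
  rw [← Finset.add_sum_erase _ _ (Finset.mem_univ (0 : Fin B))]
  congr 1
  · simp [ax, Real.sq_sqrt h, add_comm]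
  · refine Finset.sum_congr rfl fun k hk => ?_
    simp [ax, Finset.ne_of_mem_erase hk]

lemma mmseFn_eq (E τ : ℝ) (h : 0 ≤ E / τ) :
    mmseFn B E τ = E * (1 - ∫ z, wf (sqrt (E / τ)) 0 z ∂(gaussPi B)) := by
  unfold mmseFn
  congr 3
  ext z
  unfold wf Wf
  rw [← Finset.add_sum_erase _ _ (Finset.mem_univ (0 : Fin B))]
  have h1 : exp (ax (sqrt (E / τ)) 0 z) = exp (E / τ) * exp (sqrt (E / τ) * z 0) := by
    rw [← Real.exp_add]; simp [ax, Real.sq_sqrt h, add_comm]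
  have h2 : ∑ k ∈ Finset.univ.erase (0 : Fin B), exp (ax (sqrt (E / τ)) k z)
      = exp (E / τ) * (exp (-(E / τ)) * ∑ j ∈ Finset.univ.erase (0 : Fin B),
        exp (sqrt (E / τ) * z j)) := by
    rw [← mul_assoc, ← Real.exp_add, add_neg_cancel, Real.exp_zero, one_mul]
    refine Finset.sum_congr rfl fun k hk => ?_
    simp [ax, Finset.ne_of_mem_erase hk]
  rw [h1, h2, ← mul_add, mul_div_mul_left _ _ (exp_pos _).ne']

lemma miFn_deriv (E τ : ℝ) (hE : 0 < E) (hτ : 0 < τ) :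
    HasDerivAt (miFn B E) (-(mmseFn B E τ) / (2 * τ ^ 2)) τ := by
  have hs : 0 < E / τ := div_pos hE hτ
  have hg := Real.sqrt_pos.2 hs
  have hinv : HasDerivAt (fun t : ℝ => E / t) (-E / τ ^ 2) τ := by
    have := (hasDerivAt_inv hτ.ne').const_mul E
    simp only [div_eq_mul_inv]
    refine this.congr_deriv ?_
    ring
  have hL := HasDerivAt.comp τ (lam_deriv (B := B) (sqrt (E / τ))) (hinv.sqrt hs.ne')
  have := (hinv.add_const (Real.log B)).sub hL
  have ev : miFn B E =ᶠ[nhds τ] fun t => E / t + Real.log B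
      - ∫ z, log (Wf (sqrt (E / t)) z) ∂(gaussPi B) := by
    filter_upwards [lt_mem_nhds hτ] with t ht
    exact miFn_eq E t (div_pos hE ht).le
  refine (this.congr_of_eventuallyEq ev).congr_deriv ?_
  rw [mmseFn_eq E τ hs.le]
  field_simp
  ring

end main
/-- the potential function is differentiable in `ψ` on `(0, E)` with
derivative `[μ/(2(σ²+μψ)²)]·(ψ − mmse(1/(σ²+μψ)))`; consequently its stationary points
are exactly the fixed points of the state evolution map `ψ ↦ mmse(1/(σ²+μψ))`. -/
theorem stmt1 (B : ℕ) [NeZero B] (hB : 2 ≤ B) (E σ2 μ : ℝ)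
    (hE : 0 < E) (hσ : 0 < σ2) (hμ : 0 < μ) :
    ∀ ψ ∈ Set.Ioo (0 : ℝ) E,
      HasDerivAt (fun ψ' => potF B E μ σ2 ψ')
        (μ / (2 * (σ2 + μ * ψ) ^ 2) * (ψ - mmseFn B E (σ2 + μ * ψ))) ψ ∧
      (deriv (fun ψ' => potF B E μ σ2 ψ') ψ = 0 ↔ ψ = mmseFn B E (σ2 + μ * ψ)) := by
  intro ψ hψ
  have hτ : 0 < σ2 + μ * ψ := add_pos hσ (mul_pos hμ hψ.1)
  have hlin : HasDerivAt (fun ψ' : ℝ => μ * ψ') μ ψ := by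
    simpa using (hasDerivAt_id ψ).const_mul μ
  have ht : HasDerivAt (fun ψ' : ℝ => σ2 + μ * ψ') μ ψ := hlin.const_add σ2
  have h1 := HasDerivAt.comp ψ (miFn_deriv (B := B) E (σ2 + μ * ψ) hE hτ) ht
  have h2 := (ht.div_const σ2).log (div_pos hτ hσ).ne'
  have h3 := hlin.div ht hτ.ne'
  have hd : HasDerivAt (fun ψ' => potF B E μ σ2 ψ')
      (μ / (2 * (σ2 + μ * ψ) ^ 2) * (ψ - mmseFn B E (σ2 + μ * ψ))) ψ := by
    have := h1.add ((h2.sub h3).const_mul (1 / (2 * μ)))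
    refine HasDerivAt.congr_deriv this ?_
    field_simp
    ring
  refine ⟨hd, ?_⟩
  rw [hd.deriv, mul_eq_zero, sub_eq_zero]
  have : μ / (2 * (σ2 + μ * ψ) ^ 2) ≠ 0 := by positivity
  simp [this]

end
end

section
/- Let B ≥ 2 be an integer, E > 0, σ² > 0 and μ_inner > 0. Let W ∈ ℝ^{R×C} be any matrix with nonnegative entries whose columns each sum to 1. Define the spatially coupled state evolution: ψ_c⁰ = E for all c ∈ [C]; for t ≥ 0, γ_r^t = Σ_{c=1}^C W_{rc} ψ_c^t, φ_r^t = σ² + μ_inner γ_r^t for r ∈ [R], τ_c^t = [Σ_{r=1}^R W_{rc}/φ_r^t]^{-1} and ψ_c^{t+1} = mmse(1/τ_c^t) for c ∈ [C]. Then, for each r ∈ [R], the sequence (γ_r^t)_{t≥0} is non-increasing in t and converges to a limit γ_r^{SC-FP}, and for each c ∈ [C], the sequence (τ_c^t)_{t≥0} is non-increasing in t and converges to a limit τ_c^{SC-FP}. -/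
open MeasureTheory ProbabilityTheory Real Filter

noncomputable section

/-- The spatially coupled state evolution sequence `ψ_c^t` for a base matrix
`W ∈ ℝ^{R×C}`: `ψ_c⁰ = E` and `ψ_c^{t+1} = mmse(1/τ_c^t)` where
`τ_c^t = [Σ_r W_{rc}/(σ² + μ_inner Σ_{c'} W_{rc'} ψ_{c'}^t)]⁻¹`. -/
def scψ (B : ℕ) [NeZero B] (R C : ℕ) (E σ2 μin : ℝ) (W : Fin R → Fin C → ℝ) :
    ℕ → Fin C → ℝ
  | 0 => fun _ => E
  | t + 1 => fun c =>
      mmseFn B E ((∑ r : Fin R, W r c /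
        (σ2 + μin * ∑ c' : Fin C, W r c' * scψ B R C E σ2 μin W t c'))⁻¹)

/-- Spatially coupled state evolution: `γ_r^t = Σ_c W_{rc} ψ_c^t`. -/
def scγ (B : ℕ) [NeZero B] (R C : ℕ) (E σ2 μin : ℝ) (W : Fin R → Fin C → ℝ)
    (t : ℕ) (r : Fin R) : ℝ :=
  ∑ c : Fin C, W r c * scψ B R C E σ2 μin W t c

/-- Spatially coupled state evolution: `φ_r^t = σ² + μ_inner γ_r^t`. -/
def scφ (B : ℕ) [NeZero B] (R C : ℕ) (E σ2 μin : ℝ) (W : Fin R → Fin C → ℝ)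
    (t : ℕ) (r : Fin R) : ℝ :=
  σ2 + μin * scγ B R C E σ2 μin W t r

/-- Spatially coupled state evolution: `τ_c^t = [Σ_r W_{rc}/φ_r^t]⁻¹`. -/
def scτ (B : ℕ) [NeZero B] (R C : ℕ) (E σ2 μin : ℝ) (W : Fin R → Fin C → ℝ)
    (t : ℕ) (c : Fin C) : ℝ :=
  (∑ r : Fin R, W r c / scφ B R C E σ2 μin W t r)⁻¹

instance instProbGaussPi (B : ℕ) : IsProbabilityMeasure (gaussPi B) := by
  unfold gaussPi; infer_instance

/-- Gaussian rotation in one dimension. -/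
lemma gauss_rot (α β : ℝ) (h : α ^ 2 + β ^ 2 = 1) :
    ((gaussianReal 0 1).prod (gaussianReal 0 1)).map (fun p : ℝ × ℝ => α * p.1 + β * p.2)
      = gaussianReal 0 1 := by
  have h1 : ((gaussianReal 0 1).prod (gaussianReal 0 1)).map
      (fun p : ℝ × ℝ => α * p.1 + β * p.2) =
      (((gaussianReal 0 1).prod (gaussianReal 0 1)).map
        (Prod.map (α * ·) (β * ·))).map (fun p : ℝ × ℝ => p.1 + p.2) := by
    rw [Measure.map_map (by fun_prop) (by fun_prop)]
    rfl
  rw [h1, ← Measure.map_prod_map _ _ (by fun_prop) (by fun_prop),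
    gaussianReal_map_const_mul, gaussianReal_map_const_mul]
  have h2 := @gaussianReal_conv_gaussianReal (α * 0) (β * 0)
    (.mk (α ^ 2) (sq_nonneg _) * 1) (.mk (β ^ 2) (sq_nonneg _) * 1)
  rw [Measure.conv] at h2
  rw [h2]
  congr 1
  · simp
  · ext; simpa using h

lemma gaussPi_rot (B : ℕ) (α β : ℝ) (h : α ^ 2 + β ^ 2 = 1) :
    MeasurePreserving (fun p : (Fin B → ℝ) × (Fin B → ℝ) => fun i => α * p.1 i + β * p.2 i)
      ((gaussPi B).prod (gaussPi B)) (gaussPi B) := by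
  refine ⟨by fun_prop, ?_⟩
  have h0 := measurePreserving_arrowProdEquivProdArrow ℝ ℝ (Fin B)
    (fun _ => gaussianReal 0 1) (fun _ => gaussianReal 0 1)
  unfold gaussPi
  rw [← h0.map_eq, Measure.map_map (by fun_prop) h0.measurable]
  have h2 : ∀ _ : Fin B, ((gaussianReal 0 1).prod (gaussianReal 0 1)).map
      (fun p : ℝ × ℝ => α * p.1 + β * p.2) = gaussianReal 0 1 := fun _ => gauss_rot α β h
  have : ∀ _ : Fin B, SigmaFinite (((gaussianReal 0 1).prod (gaussianReal 0 1)).map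
      (fun p : ℝ × ℝ => α * p.1 + β * p.2)) := fun i => by rw [h2 i]; infer_instance
  have h1 := Measure.pi_map_pi (μ := fun _ : Fin B => (gaussianReal 0 1).prod (gaussianReal 0 1))
    (f := fun _ => fun p : ℝ × ℝ => α * p.1 + β * p.2) (fun _ => by fun_prop)
  simp_rw [gauss_rot α β h] at h1
  exact h1

/-- Inverse posterior weight. -/
def invW (B : ℕ) [NeZero B] (a : ℝ) (z : Fin B → ℝ) : ℝ :=
  1 + ∑ j ∈ Finset.univ.erase (0 : Fin B), exp (a * (z j - z 0) - a ^ 2)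

lemma one_le_invW (B : ℕ) [NeZero B] (a : ℝ) (z : Fin B → ℝ) : 1 ≤ invW B a z := by
  unfold invW
  have : 0 ≤ ∑ j ∈ Finset.univ.erase (0 : Fin B), exp (a * (z j - z 0) - a ^ 2) :=
    Finset.sum_nonneg fun _ _ => (exp_pos _).le
  linarith

lemma measurable_invW (B : ℕ) [NeZero B] (a : ℝ) : Measurable (invW B a) := by
  unfold invW; fun_prop

lemma invW_inv_nonneg (B : ℕ) [NeZero B] (a : ℝ) (z : Fin B → ℝ) : 0 ≤ (invW B a z)⁻¹ :=
  inv_nonneg.2 (zero_le_one.trans (one_le_invW B a z))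

lemma invW_inv_le (B : ℕ) [NeZero B] (a : ℝ) (z : Fin B → ℝ) : (invW B a z)⁻¹ ≤ 1 :=
  inv_le_one_of_one_le₀ (one_le_invW B a z)

lemma integrable_inv (B : ℕ) [NeZero B] (a : ℝ) :
    Integrable (fun z => (invW B a z)⁻¹) (gaussPi B) := by
  refine Integrable.of_bound (measurable_invW B a).inv.aestronglyMeasurable 1 (ae_of_all _ ?_)
  intro z
  rw [Real.norm_of_nonneg (invW_inv_nonneg B a z)]
  exact invW_inv_le B a z

lemma mmse_eq (B : ℕ) [NeZero B] (E τ : ℝ) (h : 0 ≤ E / τ) :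
    mmseFn B E τ = E * (1 - ∫ z, (invW B (sqrt (E / τ)) z)⁻¹ ∂ gaussPi B) := by
  unfold mmseFn
  congr 3
  funext z
  unfold invW
  rw [Real.sq_sqrt h]
  have hp := exp_pos (sqrt (E / τ) * z 0)
  have : exp (sqrt (E / τ) * z 0) +
        exp (-(E / τ)) * ∑ j ∈ Finset.univ.erase (0 : Fin B), exp (sqrt (E / τ) * z j)
      = exp (sqrt (E / τ) * z 0) * (1 + ∑ j ∈ Finset.univ.erase (0 : Fin B),
        exp (sqrt (E / τ) * (z j - z 0) - E / τ)) := by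
    rw [mul_add, mul_one, Finset.mul_sum, Finset.mul_sum]
    congr 1
    refine Finset.sum_congr rfl fun j _ => ?_
    rw [← exp_add, ← exp_add]
    congr 1
    ring
  rw [this, div_mul_eq_div_div, div_self hp.ne', one_div]

/-- The increment kernel is integrable with integral one. -/
lemma kernel_int (B : ℕ) [NeZero B] (b : ℝ) (j : Fin B) (hj : j ≠ 0) :
    Integrable (fun w : Fin B → ℝ => exp (b * (w j - w 0) - b ^ 2)) (gaussPi B) ∧
    ∫ w, exp (b * (w j - w 0) - b ^ 2) ∂ gaussPi B = 1 := by
  set c : Fin B → ℝ := fun k => if k = j then b else if k = 0 then -b else 0 with hc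
  have hsum : ∀ f : Fin B → ℝ → ℝ, (∀ k, f k 0 = 0) →
      ∑ k, f k (c k) = f j b + f 0 (-b) := by
    intro f hf
    rw [← Finset.sum_subset (Finset.subset_univ {j, 0})]
    · rw [Finset.sum_pair hj]; simp [hc, hj.symm]
    · intro k _ hk
      simp only [Finset.mem_insert, Finset.mem_singleton, not_or] at hk
      simp [hc, hk.1, hk.2, hf]
  have hfun : (fun w : Fin B → ℝ => exp (b * (w j - w 0) - b ^ 2)) =
      fun w => exp (-b ^ 2) * ∏ k, exp (c k * w k) := by
    funext w
    rw [← exp_sum, hsum (fun k x => x * w k) (by simp), ← exp_add]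
    congr 1
    ring
  have h1 : ∀ t : ℝ, ∫ x, exp (t * x) ∂ gaussianReal 0 1 = exp (t ^ 2 / 2) := by
    intro t
    have := congrFun (mgf_fun_id_gaussianReal (μ := 0) (v := 1)) t
    simpa [mgf] using this
  rw [hfun]
  constructor
  · refine Integrable.const_mul ?_ _
    exact Integrable.fintype_prod (f := fun k x => exp (c k * x))
      fun k => integrable_exp_mul_gaussianReal _
  · rw [integral_const_mul]
    unfold gaussPi
    rw [integral_fintype_prod_eq_prod (fun k x => exp (c k * x))]
    simp_rw [h1]
    rw [← exp_sum, hsum (fun _ x => x ^ 2 / 2) (by simp), ← exp_add, Real.exp_eq_one_iff]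
    ring

lemma F_mono (B : ℕ) [NeZero B] (a b a' : ℝ) (ha' : 0 < a') (h : a ^ 2 + b ^ 2 = a' ^ 2) :
    ∫ z, (invW B a z)⁻¹ ∂ gaussPi B ≤ ∫ z, (invW B a' z)⁻¹ ∂ gaussPi B := by
  have hrot := gaussPi_rot B (a / a') (b / a') (by field_simp; exact h)
  set P := (gaussPi B).prod (gaussPi B) with hP
  set T : (Fin B → ℝ) × (Fin B → ℝ) → Fin B → ℝ :=
    fun p i => a / a' * p.1 i + b / a' * p.2 i with hT
  have hfst : MeasurePreserving (Prod.fst : (Fin B → ℝ) × (Fin B → ℝ) → _) P (gaussPi B) :=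
    measurePreserving_fst
  have e2 : ∫ z, (invW B a' z)⁻¹ ∂ gaussPi B = ∫ p, (invW B a' (T p))⁻¹ ∂P := by
    rw [← hrot.map_eq, integral_map hrot.aemeasurable]
    exact (measurable_invW B a').inv.aestronglyMeasurable
  have e1 : ∫ z, (invW B a z)⁻¹ ∂ gaussPi B = ∫ p, (invW B a p.1)⁻¹ ∂P := by
    rw [← hfst.map_eq, integral_map hfst.aemeasurable]
    exact (measurable_invW B a).inv.aestronglyMeasurable
  have i2 : Integrable (fun p => (invW B a' (T p))⁻¹) P :=
    hrot.integrable_comp_of_integrable (integrable_inv B a')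
  have i1 : Integrable (fun p : (Fin B → ℝ) × (Fin B → ℝ) => (invW B a p.1)⁻¹) P :=
    hfst.integrable_comp_of_integrable (integrable_inv B a)
  have hD : ∀ p, invW B a' (T p) = 1 + ∑ j ∈ Finset.univ.erase (0 : Fin B),
      exp (a * (p.1 j - p.1 0) - a ^ 2) * exp (b * (p.2 j - p.2 0) - b ^ 2) := by
    intro p
    unfold invW
    congr 1
    refine Finset.sum_congr rfl fun j _ => ?_
    rw [← exp_add]
    congr 1
    rw [← h, hT]
    field_simp
    ring
  -- the factor depending on the first observation
  let g : Fin B → (Fin B → ℝ) → ℝ := fun j y =>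
    ((invW B a y)⁻¹) ^ 2 * exp (a * (y j - y 0) - a ^ 2)
  have gi : ∀ j ∈ Finset.univ.erase (0 : Fin B), Integrable (g j) (gaussPi B) := by
    intro j hj
    refine Integrable.of_bound (C := 1) ?_ (ae_of_all _ fun y => ?_)
    · have := measurable_invW B a
      exact Measurable.aestronglyMeasurable (by fun_prop)
    · have hl := invW_inv_nonneg B a y
      have hl1 := invW_inv_le B a y
      have hpos : 0 < invW B a y := zero_lt_one.trans_le (one_le_invW B a y)
      have hle : exp (a * (y j - y 0) - a ^ 2) ≤ invW B a y := by
        have := Finset.single_le_sum (f := fun j => exp (a * (y j - y 0) - a ^ 2))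
          (fun i _ => (exp_pos _).le) hj
        unfold invW
        linarith
      have : (invW B a y)⁻¹ * exp (a * (y j - y 0) - a ^ 2) ≤ 1 := by
        calc _ ≤ (invW B a y)⁻¹ * invW B a y := by gcongr
          _ = 1 := inv_mul_cancel₀ hpos.ne'
      have h0 : 0 ≤ (invW B a y)⁻¹ * exp (a * (y j - y 0) - a ^ 2) := by positivity
      simp only [g]
      rw [Real.norm_of_nonneg (by positivity), pow_two, mul_assoc]
      exact mul_le_one₀ hl1 h0 this
  have gk : ∀ j ∈ Finset.univ.erase (0 : Fin B),
      Integrable (fun p : (Fin B → ℝ) × (Fin B → ℝ) =>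
        g j p.1 * exp (b * (p.2 j - p.2 0) - b ^ 2)) P ∧
      ∫ p, g j p.1 * exp (b * (p.2 j - p.2 0) - b ^ 2) ∂P = ∫ p, g j p.1 ∂P := by
    intro j hj
    obtain ⟨k1, k2⟩ := kernel_int B b j (Finset.ne_of_mem_erase hj)
    refine ⟨(gi j hj).mul_prod k1, ?_⟩
    rw [hP, integral_prod_mul (g j) (fun w : Fin B → ℝ => exp (b * (w j - w 0) - b ^ 2)), k2,
      mul_one]
    rw [← hP, ← hfst.map_eq, integral_map hfst.aemeasurable]
    rw [hfst.map_eq]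
    exact (gi j hj).aestronglyMeasurable
  have gi' : ∀ j ∈ Finset.univ.erase (0 : Fin B),
      Integrable (fun p : (Fin B → ℝ) × (Fin B → ℝ) => g j p.1) P := fun j hj =>
    hfst.integrable_comp_of_integrable (gi j hj)
  have isq : Integrable (fun p : (Fin B → ℝ) × (Fin B → ℝ) => ((invW B a p.1)⁻¹) ^ 2) P := by
    refine Integrable.of_bound (C := 1) ?_ (ae_of_all _ fun p => ?_)
    · have := measurable_invW B a
      exact Measurable.aestronglyMeasurable (by fun_prop)
    · rw [Real.norm_of_nonneg (by positivity)]
      exact pow_le_one₀ (invW_inv_nonneg B a p.1) (invW_inv_le B a p.1)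
  -- second moment terms
  have f2 : ∀ p, ((invW B a p.1)⁻¹) ^ 2 * invW B a' (T p) = ((invW B a p.1)⁻¹) ^ 2 +
      ∑ j ∈ Finset.univ.erase (0 : Fin B), g j p.1 * exp (b * (p.2 j - p.2 0) - b ^ 2) := by
    intro p
    rw [hD, mul_add, mul_one, Finset.mul_sum]
    congr 1
    exact Finset.sum_congr rfl fun j _ => by simp only [g]; ring
  have f1 : ∀ p : (Fin B → ℝ) × (Fin B → ℝ), (invW B a p.1)⁻¹ = ((invW B a p.1)⁻¹) ^ 2 +
      ∑ j ∈ Finset.univ.erase (0 : Fin B), g j p.1 := by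
    intro p
    have hpos : invW B a p.1 ≠ 0 := (zero_lt_one.trans_le (one_le_invW B a p.1)).ne'
    calc (invW B a p.1)⁻¹ = ((invW B a p.1)⁻¹) ^ 2 * invW B a p.1 := by field_simp
      _ = _ := by
        simp only [g]
        rw [← Finset.mul_sum]
        nth_rewrite 2 [invW]
        ring
  have iI : Integrable (fun p => ((invW B a p.1)⁻¹) ^ 2 * invW B a' (T p)) P := by
    simp_rw [f2]
    exact isq.add (integrable_finsetSum _ fun j hj => (gk j hj).1)
  have eI : ∫ p, ((invW B a p.1)⁻¹) ^ 2 * invW B a' (T p) ∂P = ∫ p, (invW B a p.1)⁻¹ ∂P := by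
    have r1 : ∫ p : (Fin B → ℝ) × (Fin B → ℝ), (invW B a p.1)⁻¹ ∂P =
        ∫ p, (((invW B a p.1)⁻¹) ^ 2 + ∑ j ∈ Finset.univ.erase (0 : Fin B), g j p.1) ∂P :=
      integral_congr_ae (ae_of_all _ f1)
    rw [r1]
    simp_rw [f2]
    rw [integral_add isq (integrable_finsetSum _ fun j hj => (gk j hj).1),
      integral_add isq (integrable_finsetSum _ gi'),
      integral_finsetSum _ (fun j hj => (gk j hj).1), integral_finset_sum _ gi']
    congr 1
    exact Finset.sum_congr rfl fun j hj => (gk j hj).2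
  rw [e1, e2]
  calc ∫ p, (invW B a p.1)⁻¹ ∂P
      = ∫ p, (2 * (invW B a p.1)⁻¹ - ((invW B a p.1)⁻¹) ^ 2 * invW B a' (T p)) ∂P := by
        rw [integral_sub (i1.const_mul 2) iI, integral_const_mul, eI]; ring
    _ ≤ _ := by
        refine integral_mono ((i1.const_mul 2).sub iI) i2 fun p => ?_
        have hpos : 0 < invW B a' (T p) := zero_lt_one.trans_le (one_le_invW B a' (T p))
        simp only
        set l := (invW B a p.1)⁻¹
        set D := invW B a' (T p)
        have : D⁻¹ - (2 * l - l ^ 2 * D) = D⁻¹ * (1 - l * D) ^ 2 := by field_simp; ring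
        have h3 : 0 ≤ D⁻¹ * (1 - l * D) ^ 2 := by positivity
        linarith

lemma mmse_mono (B : ℕ) [NeZero B] (E τ τ' : ℝ) (hE : 0 < E) (h' : 0 < τ') (h : τ' ≤ τ) :
    mmseFn B E τ' ≤ mmseFn B E τ := by
  have hτ : 0 < τ := h'.trans_le h
  have hs : E / τ ≤ E / τ' := by gcongr
  rw [mmse_eq B E τ (by positivity), mmse_eq B E τ' (by positivity)]
  have := F_mono B (sqrt (E / τ)) (sqrt (E / τ' - E / τ)) (sqrt (E / τ')) (by positivity) (by
    rw [Real.sq_sqrt (by positivity), Real.sq_sqrt (by linarith), Real.sq_sqrt (by positivity)]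
    ring)
  gcongr

lemma mmse_bounds (B : ℕ) [NeZero B] (E τ : ℝ) (hE : 0 < E) (hτ : 0 < τ) :
    0 ≤ mmseFn B E τ ∧ mmseFn B E τ ≤ E := by
  rw [mmse_eq B E τ (by positivity)]
  have h0 : 0 ≤ ∫ z, (invW B (sqrt (E / τ)) z)⁻¹ ∂ gaussPi B :=
    integral_nonneg fun z => invW_inv_nonneg B _ z
  have h1 : ∫ z, (invW B (sqrt (E / τ)) z)⁻¹ ∂ gaussPi B ≤ 1 := by
    have := integral_mono (integrable_inv B (sqrt (E / τ))) (integrable_const (1 : ℝ))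
      (fun z => invW_inv_le B _ z)
    simpa using this
  constructor
  · exact mul_nonneg hE.le (by linarith)
  · nlinarith

/-- One step of the recursion on the level of `τ`. -/
def tauOf (R C : ℕ) (σ2 μin : ℝ) (W : Fin R → Fin C → ℝ) (ψ : Fin C → ℝ) (c : Fin C) : ℝ :=
  (∑ r : Fin R, W r c / (σ2 + μin * ∑ c' : Fin C, W r c' * ψ c'))⁻¹

lemma tauOf_props (R C : ℕ) (σ2 μin : ℝ) (hσ : 0 < σ2) (hμ : 0 < μin) (W : Fin R → Fin C → ℝ)
    (hW0 : ∀ r c, 0 ≤ W r c) (hWcol : ∀ c, ∑ r : Fin R, W r c = 1)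
    (ψ : Fin C → ℝ) (hψ : ∀ c, 0 ≤ ψ c) (c : Fin C) :
    0 < tauOf R C σ2 μin W ψ c ∧
    ∀ ψ' : Fin C → ℝ, (∀ c, ψ c ≤ ψ' c) → tauOf R C σ2 μin W ψ c ≤ tauOf R C σ2 μin W ψ' c := by
  have hφ : ∀ ψ : Fin C → ℝ, (∀ c, 0 ≤ ψ c) → ∀ r,
      0 < σ2 + μin * ∑ c' : Fin C, W r c' * ψ c' := fun ψ hψ r => by
    have : 0 ≤ ∑ c' : Fin C, W r c' * ψ c' :=
      Finset.sum_nonneg fun c' _ => mul_nonneg (hW0 r c') (hψ c')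
    positivity
  have hpos : ∀ ψ : Fin C → ℝ, (∀ c, 0 ≤ ψ c) →
      0 < ∑ r : Fin R, W r c / (σ2 + μin * ∑ c' : Fin C, W r c' * ψ c') := fun ψ hψ => by
    have hne : ∃ r ∈ Finset.univ, 0 < W r c := by
      by_contra! hcon
      have := Finset.sum_nonpos hcon
      rw [hWcol c] at this
      linarith
    obtain ⟨r, _, hr⟩ := hne
    exact Finset.sum_pos' (fun r _ => div_nonneg (hW0 r c) (hφ ψ hψ r).le)
      ⟨r, Finset.mem_univ _, div_pos hr (hφ ψ hψ r)⟩
  refine ⟨inv_pos.2 (hpos ψ hψ), fun ψ' h => ?_⟩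
  have hψ' : ∀ c, 0 ≤ ψ' c := fun c => (hψ c).trans (h c)
  unfold tauOf
  refine inv_anti₀ (hpos ψ' hψ') (Finset.sum_le_sum fun r _ => ?_)
  refine div_le_div_of_nonneg_left (hW0 r c) (hφ ψ hψ r) ?_
  have : ∑ c' : Fin C, W r c' * ψ c' ≤ ∑ c' : Fin C, W r c' * ψ' c' :=
    Finset.sum_le_sum fun c' _ => mul_le_mul_of_nonneg_left (h c') (hW0 r c')
  gcongr

lemma conv_of_anti (u : ℕ → ℝ) (h : ∀ t, u (t + 1) ≤ u t) (h0 : ∀ t, 0 ≤ u t) :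
    ∃ l : ℝ, Tendsto u atTop (nhds l) :=
  ⟨_, tendsto_atTop_ciInf (antitone_nat_of_succ_le h) ⟨0, by rintro _ ⟨t, rfl⟩; exact h0 t⟩⟩

/-- for any base matrix with nonnegative entries and unit column sums,
each `γ_r^t` is non-increasing in `t` and converges, and each `τ_c^t` is non-increasing
in `t` and converges. -/
theorem stmt3 (B : ℕ) [NeZero B] (hB : 2 ≤ B) (E σ2 μin : ℝ)
    (hE : 0 < E) (hσ : 0 < σ2) (hμ : 0 < μin)
    (R C : ℕ) (W : Fin R → Fin C → ℝ)
    (hW0 : ∀ r c, 0 ≤ W r c) (hWcol : ∀ c, ∑ r : Fin R, W r c = 1) :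
    (∀ r : Fin R,
      (∀ t, scγ B R C E σ2 μin W (t + 1) r ≤ scγ B R C E σ2 μin W t r) ∧
      ∃ γFP : ℝ, Tendsto (fun t => scγ B R C E σ2 μin W t r) atTop (nhds γFP)) ∧
    (∀ c : Fin C,
      (∀ t, scτ B R C E σ2 μin W (t + 1) c ≤ scτ B R C E σ2 μin W t c) ∧
      ∃ τFP : ℝ, Tendsto (fun t => scτ B R C E σ2 μin W t c) atTop (nhds τFP)) := by
  have hψ0 : ∀ t c, 0 ≤ scψ B R C E σ2 μin W t c ∧ scψ B R C E σ2 μin W t c ≤ E := by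
    intro t
    induction t with
    | zero => intro c; exact ⟨hE.le, le_refl E⟩
    | succ t ih =>
      intro c
      exact mmse_bounds B E _ hE
        (tauOf_props R C σ2 μin hσ hμ W hW0 hWcol _ (fun c => (ih c).1) c).1
  have hmono : ∀ t c, scψ B R C E σ2 μin W (t + 1) c ≤ scψ B R C E σ2 μin W t c := by
    intro t
    induction t with
    | zero => intro c; exact (hψ0 1 c).2
    | succ t ih =>
      intro c
      have hp := tauOf_props R C σ2 μin hσ hμ W hW0 hWcol _ (fun c => (hψ0 (t + 1) c).1) c
      exact mmse_mono B E _ _ hE hp.1 (hp.2 _ ih)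
  constructor
  · intro r
    have h1 : ∀ t, scγ B R C E σ2 μin W (t + 1) r ≤ scγ B R C E σ2 μin W t r := fun t =>
      Finset.sum_le_sum fun c _ => mul_le_mul_of_nonneg_left (hmono t c) (hW0 r c)
    exact ⟨h1, conv_of_anti _ h1 fun t =>
      Finset.sum_nonneg fun c _ => mul_nonneg (hW0 r c) (hψ0 t c).1⟩
  · intro c
    have hp := fun t => tauOf_props R C σ2 μin hσ hμ W hW0 hWcol _ (fun c => (hψ0 t c).1) c
    have h1 : ∀ t, scτ B R C E σ2 μin W (t + 1) c ≤ scτ B R C E σ2 μin W t c := fun t =>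
      (hp (t + 1)).2 _ (hmono t)
    exact ⟨h1, conv_of_anti _ h1 fun t => (hp t).1.le⟩

end
end
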